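/- arXiv:1807.05402 — 2 statements merged into one kernel-verified Lean document; each statement's English description precedes it below -/
import Mathlib

section
/- Fix g > 1, ω > 1, γ ≥ 1, η ∈ (0,1). Let S_T(μ) := h(ν₁(μ)) + h(ν₂(μ)) with ν₁, ν₂ the symplectic eigenvalues of Eve's total CM [[((g−1)μ+gω)I, √(g(ω²−1))Z],[√(g(ω²−1))Z, ωI]], and let S_C(μ) := h(ν̄₁(μ)) + h(ν̄₂(μ)) with ν̄₁, ν̄₂ the symplectic eigenvalues of the conditional CM M(μ) = V_{E′e}(μ) − (1/(ημ+(1−η)γ))·u(μ)·u(μ)ᵀ, u(μ) = (√((g−1)η(μ²−1)),0,0,0)ᵀ. Then the Holevo quantity χ_AE(μ) := S_T(μ) − S_C(μ) satisfies: χ_AE(μ) − [ (1/2)·log₂( (g−1)·η·μ / (g·η·ω + γ·(g−1)·(1−η)) ) + h(ω) − h(ν̄₂∞) ] tends to 0 as μ → ∞, where ν̄₂∞ := √( ω·[g·η + γ·ω·(g−1)·(1−η)] / (g·η·ω + γ·(g−1)·(1−η)) ). -/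
open Real Filter Matrix Polynomial

/-- The standard two-mode symplectic form `Ω₂`. -/
noncomputable def Omega2 : Matrix (Fin 4) (Fin 4) ℝ :=
  !![0, 1, 0, 0; -1, 0, 0, 0; 0, 0, 0, 1; 0, 0, -1, 0]

/-- Eve's total covariance matrix
`V_{E′e}(μ) = [[((g−1)μ+gω)I, √(g(ω²−1))Z],[√(g(ω²−1))Z, ωI]]`. -/
noncomputable def VEe (g ω μ : ℝ) : Matrix (Fin 4) (Fin 4) ℝ :=
  !![(g - 1) * μ + g * ω, 0, Real.sqrt (g * (ω ^ 2 - 1)), 0;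
     0, (g - 1) * μ + g * ω, 0, -Real.sqrt (g * (ω ^ 2 - 1));
     Real.sqrt (g * (ω ^ 2 - 1)), 0, ω, 0;
     0, -Real.sqrt (g * (ω ^ 2 - 1)), 0, ω]

/-- The DR conditioning vector `u(μ) = (√((g−1)η(μ²−1)), 0, 0, 0)ᵀ`. -/
noncomputable def uDR (g η μ : ℝ) : Fin 4 → ℝ :=
  ![Real.sqrt ((g - 1) * η * (μ ^ 2 - 1)), 0, 0, 0]

/-- Eve's conditional covariance matrix after Alice's `q`-homodyne:
`M(μ) = V_{E′e}(μ) − (1/(ημ+(1−η)γ))·u(μ)u(μ)ᵀ`. -/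
noncomputable def Mdr (g ω γ η μ : ℝ) : Matrix (Fin 4) (Fin 4) ℝ :=
  VEe g ω μ - (η * μ + (1 - η) * γ)⁻¹ • Matrix.vecMulVec (uDR g η μ) (uDR g η μ)

/-- The bosonic entropy function. -/
noncomputable def h (x : ℝ) : ℝ :=
  ((x + 1) / 2) * Real.logb 2 ((x + 1) / 2) - ((x - 1) / 2) * Real.logb 2 ((x - 1) / 2)

/-- `Δ(μ)` for Eve's total covariance matrix `V_{E′e}(μ)`. -/
noncomputable def Delta (g ω μ : ℝ) : ℝ :=
  ((g - 1) * μ + g * ω) ^ 2 + ω ^ 2 - 2 * (g * (ω ^ 2 - 1))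

/-- `D(μ)` for Eve's total covariance matrix `V_{E′e}(μ)`. -/
noncomputable def Dprod (g ω μ : ℝ) : ℝ :=
  (((g - 1) * μ + g * ω) * ω - g * (ω ^ 2 - 1)) ^ 2

/-- The larger symplectic eigenvalue of `V_{E′e}(μ)`. -/
noncomputable def nu1 (g ω μ : ℝ) : ℝ :=
  Real.sqrt ((Delta g ω μ + Real.sqrt ((Delta g ω μ) ^ 2 - 4 * Dprod g ω μ)) / 2)

/-- The smaller symplectic eigenvalue of `V_{E′e}(μ)`. -/
noncomputable def nu2 (g ω μ : ℝ) : ℝ :=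
  Real.sqrt ((Delta g ω μ - Real.sqrt ((Delta g ω μ) ^ 2 - 4 * Dprod g ω μ)) / 2)

lemma aux_h_cont : Continuous h := by
  have h1 : Continuous (fun x : ℝ => x * Real.log x) := Real.continuous_mul_log
  have e : h = fun x => (((x + 1) / 2) * Real.log ((x + 1) / 2)
      - ((x - 1) / 2) * Real.log ((x - 1) / 2)) / Real.log 2 := by
    funext x
    simp only [h, Real.logb]
    ring
  rw [e]
  have h2 : Continuous (fun x : ℝ => ((x + 1) / 2) * Real.log ((x + 1) / 2)) :=
    h1.comp (by fun_prop : Continuous fun x : ℝ => (x + 1) / 2)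
  have h3 : Continuous (fun x : ℝ => ((x - 1) / 2) * Real.log ((x - 1) / 2)) :=
    h1.comp (by fun_prop : Continuous fun x : ℝ => (x - 1) / 2)
  exact (h2.sub h3).div_const _

lemma aux_h_asymp : ∃ c : ℝ, Tendsto (fun x => h x - Real.logb 2 x) atTop (nhds c) := by
  have t1 := Real.tendsto_mul_log_one_add_div_atTop 1
  have t2 := Real.tendsto_mul_log_one_add_div_atTop (-1)
  have l : ∀ t : ℝ, Tendsto (fun x : ℝ => Real.log (1 + t / x)) atTop (nhds 0) := by
    intro t
    have h0 : Tendsto (fun x : ℝ => 1 + t / x) atTop (nhds (1 + 0)) :=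
      (tendsto_const_nhds).add (tendsto_const_nhds.div_atTop tendsto_id)
    rw [add_zero] at h0
    simpa using h0.log one_ne_zero
  have key := ((((t1.add (l 1)).sub t2).add (l (-1))).div_const 2).sub_const (Real.log 2)
    |>.div_const (Real.log 2)
  refine ⟨_, key.congr' ?_⟩
  filter_upwards [eventually_gt_atTop 1] with x hx
  have hx0 : 0 < x := by linarith
  have e1 : Real.log ((x + 1) / 2) = Real.log x + Real.log (1 + 1 / x) - Real.log 2 := by
    rw [Real.log_div (by linarith) (by norm_num), ← Real.log_mul (by linarith) (by positivity)]
    congr 2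
    field_simp
  have hp : 0 < 1 + -1 / x := by
    have : 1 + -1 / x = (x - 1) / x := by field_simp; ring
    rw [this]
    exact div_pos (by linarith) hx0
  have e2 : Real.log ((x - 1) / 2) = Real.log x + Real.log (1 + -1 / x) - Real.log 2 := by
    rw [Real.log_div (by linarith) (by norm_num), ← Real.log_mul (by linarith) hp.ne']
    congr 2
    field_simp
    ring
  have h2 : Real.log 2 ≠ 0 := (Real.log_pos (by norm_num)).ne'
  simp only [h, Real.logb, e1, e2]
  field_simp
  ring

lemma aux_eig (Δ D s P Q : ℝ → ℝ) (hs : Tendsto s atTop atTop)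
    (hP : ContinuousAt P 0) (hQ : ContinuousAt Q 0) (hP0 : 0 < P 0)
    (hΔ : ∀ᶠ μ in atTop, Δ μ = s μ * P μ⁻¹) (hD : ∀ᶠ μ in atTop, D μ = s μ * Q μ⁻¹) :
    Tendsto (fun μ => (Δ μ + √((Δ μ) ^ 2 - 4 * D μ)) / 2 / s μ) atTop (nhds (P 0)) ∧
    Tendsto (fun μ => (Δ μ - √((Δ μ) ^ 2 - 4 * D μ)) / 2) atTop (nhds (Q 0 / P 0)) := by
  have tP : Tendsto (fun μ : ℝ => P μ⁻¹) atTop (nhds (P 0)) :=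
    hP.tendsto.comp tendsto_inv_atTop_zero
  have tQ : Tendsto (fun μ : ℝ => Q μ⁻¹) atTop (nhds (Q 0)) :=
    hQ.tendsto.comp tendsto_inv_atTop_zero
  have tq : Tendsto (fun μ : ℝ => 4 * Q μ⁻¹ / s μ) atTop (nhds 0) :=
    (tQ.const_mul 4).div_atTop hs
  have tr : Tendsto (fun μ : ℝ => (P μ⁻¹) ^ 2 - 4 * Q μ⁻¹ / s μ) atTop (nhds ((P 0) ^ 2)) := by
    simpa using (tP.pow 2).sub tq
  have trs : Tendsto (fun μ : ℝ => √((P μ⁻¹) ^ 2 - 4 * Q μ⁻¹ / s μ)) atTop (nhds (P 0)) := by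
    have := tr.sqrt
    rwa [Real.sqrt_sq hP0.le] at this
  have t1 : Tendsto (fun μ => (Δ μ + √((Δ μ) ^ 2 - 4 * D μ)) / 2 / s μ) atTop (nhds (P 0)) := by
    have := (tP.add trs).div_const 2
    rw [add_self_div_two] at this
    refine this.congr' ?_
    filter_upwards [hs.eventually_gt_atTop 0, hΔ, hD] with μ h0 e1 e2
    have : Δ μ ^ 2 - 4 * D μ = (s μ) ^ 2 * ((P μ⁻¹) ^ 2 - 4 * Q μ⁻¹ / s μ) := by
      rw [e1, e2]; field_simp
    rw [this, Real.sqrt_mul (sq_nonneg _), Real.sqrt_sq h0.le, e1]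
    field_simp
  refine ⟨t1, ?_⟩
  refine (tQ.div t1 hP0.ne').congr' ?_
  filter_upwards [hs.eventually_gt_atTop 0, hΔ, hD, t1.eventually (lt_mem_nhds hP0),
    tr.eventually (lt_mem_nhds (by positivity : 0 < P 0 ^ 2))] with μ h0 e1 e2 h3 h4
  have hd : 0 ≤ Δ μ ^ 2 - 4 * D μ := by
    have : Δ μ ^ 2 - 4 * D μ = (s μ) ^ 2 * ((P μ⁻¹) ^ 2 - 4 * Q μ⁻¹ / s μ) := by
      rw [e1, e2]; field_simp
    rw [this]; positivity
  have hsq := Real.sq_sqrt hd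
  simp only [Pi.div_apply]
  rw [div_eq_iff h3.ne', mul_div_assoc', eq_div_iff h0.ne', mul_comm, ← e2]
  nlinarith

lemma aux_char (g ω γ η μ d D : ℝ) (hg : 1 < g) (hω : 1 < ω) (hγ : 1 ≤ γ)
    (hη : η ∈ Set.Ioo (0 : ℝ) 1) (hμ : 1 < μ)
    (hc : Matrix.charpoly (Omega2 * Mdr g ω γ η μ) = X ^ 4 + C d * X ^ 2 + C D) :
    d = ((g - 1) * μ + g * ω - (g - 1) * η * (μ ^ 2 - 1) / (η * μ + (1 - η) * γ))
        * ((g - 1) * μ + g * ω) + ω ^ 2 - 2 * (g * (ω ^ 2 - 1)) ∧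
    D = (((g - 1) * μ + g * ω - (g - 1) * η * (μ ^ 2 - 1) / (η * μ + (1 - η) * γ)) * ω
          - g * (ω ^ 2 - 1)) * (((g - 1) * μ + g * ω) * ω - g * (ω ^ 2 - 1)) := by
  have hc2 : √(g * (ω ^ 2 - 1)) ^ 2 = g * (ω ^ 2 - 1) :=
    Real.sq_sqrt (mul_nonneg (by linarith) (by nlinarith))
  have hu2 : √((g - 1) * η * (μ ^ 2 - 1)) * √((g - 1) * η * (μ ^ 2 - 1))
      = (g - 1) * η * (μ ^ 2 - 1) :=
    Real.mul_self_sqrt (mul_nonneg (mul_nonneg (by linarith) hη.1.le) (by nlinarith))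
  generalize hq : (g - 1) * μ + g * ω - (g - 1) * η * (μ ^ 2 - 1) / (η * μ + (1 - η) * γ) = q
  generalize ha : (g - 1) * μ + g * ω = a at *
  have hM : Omega2 * Mdr g ω γ η μ =
      !![0, a, 0, -√(g * (ω ^ 2 - 1)); -q, 0, -√(g * (ω ^ 2 - 1)), 0;
        0, -√(g * (ω ^ 2 - 1)), 0, ω; -√(g * (ω ^ 2 - 1)), 0, -ω, 0] := by
    have hq' : a - (η * μ + (1 - η) * γ)⁻¹ *
        (√((g - 1) * η * (μ ^ 2 - 1)) * √((g - 1) * η * (μ ^ 2 - 1))) = q := by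
      rw [hu2, ← hq]; ring
    have hM0 : Mdr g ω γ η μ = !![q, 0, √(g * (ω ^ 2 - 1)), 0; 0, a, 0, -√(g * (ω ^ 2 - 1));
        √(g * (ω ^ 2 - 1)), 0, ω, 0; 0, -√(g * (ω ^ 2 - 1)), 0, ω] := by
      ext i j
      rw [Mdr, Matrix.sub_apply, Matrix.smul_apply, Matrix.vecMulVec_apply]
      fin_cases i <;> fin_cases j <;> simp [VEe, uDR, ha]
      linarith
    rw [hM0]
    ext i j
    fin_cases i <;> fin_cases j <;> simp [Omega2, Matrix.mul_apply, Fin.sum_univ_succ]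
  rw [hM] at hc
  generalize √(g * (ω ^ 2 - 1)) = c at *
  have ev : ∀ x : ℝ, (Matrix.scalar (Fin 4) x - !![0, a, 0, -c; -q, 0, -c, 0;
        0, -c, 0, ω; -c, 0, -ω, 0]).det = x ^ 4 + d * x ^ 2 + D := by
    intro x
    rw [← Matrix.eval_charpoly, hc]
    simp
  have ev2 : ∀ x : ℝ, (Matrix.scalar (Fin 4) x - !![0, a, 0, -c; -q, 0, -c, 0;
        0, -c, 0, ω; -c, 0, -ω, 0]).det =
        x ^ 4 + (q * a + ω ^ 2 - 2 * c ^ 2) * x ^ 2 + (q * ω - c ^ 2) * (a * ω - c ^ 2) := by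
    intro x
    have : Matrix.scalar (Fin 4) x - !![0, a, 0, -c; -q, 0, -c, 0; 0, -c, 0, ω; -c, 0, -ω, 0]
        = !![x, -a, 0, c; q, x, c, 0; 0, c, x, -ω; c, 0, ω, x] := by
      ext i j
      fin_cases i <;> fin_cases j <;> simp
    rw [this]
    simp [Matrix.det_succ_row_zero, Fin.sum_univ_succ, Fin.succAbove]
    ring
  have z0 := (ev 0).symm.trans (ev2 0)
  have z1 := (ev 1).symm.trans (ev2 1)
  rw [← hc2]
  constructor <;> linarith

/-- Asymptotics of the DR Holevo quantity: `χ_AE(μ) = S_T(μ) − S_C(μ)` satisfies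
`χ_AE(μ) − [(1/2)log₂((g−1)ημ/(gηω+γ(g−1)(1−η))) + h(ω) − h(ν̄₂∞)] → 0` as `μ → ∞`. -/
theorem holevo_asymptotic_DR (g ω γ η : ℝ)
    (hg : 1 < g) (hω : 1 < ω) (hγ : 1 ≤ γ) (hη : η ∈ Set.Ioo (0 : ℝ) 1)
    (Δb Db : ℝ → ℝ)
    (hchar : ∀ μ : ℝ, 1 < μ →
      Matrix.charpoly (Omega2 * Mdr g ω γ η μ) =
        X ^ 4 + C (Δb μ) * X ^ 2 + C (Db μ)) :
    Filter.Tendsto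
      (fun μ : ℝ =>
        ((h (nu1 g ω μ) + h (nu2 g ω μ))
            - (h (Real.sqrt ((Δb μ + Real.sqrt ((Δb μ) ^ 2 - 4 * Db μ)) / 2))
              + h (Real.sqrt ((Δb μ - Real.sqrt ((Δb μ) ^ 2 - 4 * Db μ)) / 2))))
          - ((1 / 2) * Real.logb 2
                ((g - 1) * η * μ / (g * η * ω + γ * (g - 1) * (1 - η)))
              + h ω
              - h (Real.sqrt (ω * (g * η + γ * ω * (g - 1) * (1 - η)) /
                  (g * η * ω + γ * (g - 1) * (1 - η))))))
      Filter.atTop (nhds 0) := by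
  obtain ⟨hη0, hη1⟩ := hη
  have hk : 0 < γ * (g - 1) * (1 - η) :=
    mul_pos (mul_pos (by linarith) (by linarith)) (by linarith)
  have hg0 : 0 < g - 1 := by linarith
  have hω0 : 0 < ω := by linarith
  have hgη : 0 < g * η := by positivity
  have hK : 0 < g * η * ω + γ * (g - 1) * (1 - η) := by positivity
  -- total state
  obtain ⟨T1, T2⟩ := aux_eig (Delta g ω) (Dprod g ω) (fun μ => μ ^ 2)
    (fun t => ((g - 1) + g * ω * t) ^ 2 + (ω ^ 2 - 2 * (g * (ω ^ 2 - 1))) * t ^ 2)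
    (fun t => (((g - 1) + g * ω * t) * ω - g * (ω ^ 2 - 1) * t) ^ 2)
    (tendsto_pow_atTop two_ne_zero) (by fun_prop) (by fun_prop)
    (by have : 0 < (g - 1) ^ 2 := by positivity
        simpa using this)
    (by
      filter_upwards [eventually_gt_atTop 0] with μ hμ
      simp only [Delta]; field_simp; ring)
    (by
      filter_upwards [eventually_gt_atTop 0] with μ hμ
      simp only [Dprod]; field_simp)
  -- conditional state
  obtain ⟨C1, C2⟩ := aux_eig Δb Db (fun μ => μ)
    (fun t => (g * ω + (g - 1) * ((1 - η) * γ + η * t) / (η + (1 - η) * γ * t))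
      * ((g - 1) + g * ω * t) + (ω ^ 2 - 2 * (g * (ω ^ 2 - 1))) * t)
    (fun t => ((g * ω + (g - 1) * ((1 - η) * γ + η * t) / (η + (1 - η) * γ * t)) * ω
      - g * (ω ^ 2 - 1)) * (((g - 1) + g * ω * t) * ω - g * (ω ^ 2 - 1) * t))
    tendsto_id
    (by fun_prop (disch := simp; exact hη0.ne')) (by fun_prop (disch := simp; exact hη0.ne'))
    (by
      have : 0 < (1 - η) * γ := mul_pos (by linarith) (by linarith)
      simp only [mul_zero, add_zero]; positivity)
    (by
      filter_upwards [eventually_gt_atTop 1] with μ hμ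
      rw [(aux_char g ω γ η μ _ _ hg hω hγ ⟨hη0, hη1⟩ hμ (hchar μ hμ)).1]
      have h1 : 0 < (1 - η) * γ := mul_pos (by linarith) (by linarith)
      have h0 : 0 < μ := by linarith
      have h2 : η * μ + (1 - η) * γ ≠ 0 := by positivity
      have h3 : η + (1 - η) * γ * μ⁻¹ ≠ 0 := by positivity
      have e : (g - 1) * μ + g * ω - (g - 1) * η * (μ ^ 2 - 1) / (η * μ + (1 - η) * γ) =
          g * ω + (g - 1) * ((1 - η) * γ + η * μ⁻¹) / (η + (1 - η) * γ * μ⁻¹) := by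
        have h4 : η + (1 - η) * γ * μ⁻¹ = (η * μ + (1 - η) * γ) / μ := by field_simp
        rw [h4]
        field_simp
        ring
      rw [e]
      generalize g * ω + (g - 1) * ((1 - η) * γ + η * μ⁻¹) / (η + (1 - η) * γ * μ⁻¹) = q
      field_simp
      ring)
    (by
      filter_upwards [eventually_gt_atTop 1] with μ hμ
      rw [(aux_char g ω γ η μ _ _ hg hω hγ ⟨hη0, hη1⟩ hμ (hchar μ hμ)).2]
      have h1 : 0 < (1 - η) * γ := mul_pos (by linarith) (by linarith)
      have h0 : 0 < μ := by linarith
      have h2 : η * μ + (1 - η) * γ ≠ 0 := by positivity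
      have h3 : η + (1 - η) * γ * μ⁻¹ ≠ 0 := by positivity
      have e : (g - 1) * μ + g * ω - (g - 1) * η * (μ ^ 2 - 1) / (η * μ + (1 - η) * γ) =
          g * ω + (g - 1) * ((1 - η) * γ + η * μ⁻¹) / (η + (1 - η) * γ * μ⁻¹) := by
        have h4 : η + (1 - η) * γ * μ⁻¹ = (η * μ + (1 - η) * γ) / μ := by field_simp
        rw [h4]
        field_simp
        ring
      rw [e]
      generalize g * ω + (g - 1) * ((1 - η) * γ + η * μ⁻¹) / (η + (1 - η) * γ * μ⁻¹) = q
      field_simp)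
  simp only [mul_zero, add_zero, sub_zero] at T1 T2 C1 C2
  have T2' : Tendsto (fun μ => h (nu2 g ω μ)) atTop (nhds (h ω)) := by
    have := T2.sqrt
    have e : √(((g - 1) * ω) ^ 2 / ((g - 1) ^ 2 + (ω ^ 2 - 2 * (g * (ω ^ 2 - 1))) * 0 ^ 2)) = ω := by
      rw [show ((g - 1) * ω) ^ 2 / ((g - 1) ^ 2 + (ω ^ 2 - 2 * (g * (ω ^ 2 - 1))) * 0 ^ 2)
        = ω ^ 2 by field_simp; simp, Real.sqrt_sq hω0.le]
    rw [e] at this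
    exact (aux_h_cont.tendsto ω).comp this
  have eA : g * ω + (g - 1) * ((1 - η) * γ) / η
      = (g * η * ω + γ * (g - 1) * (1 - η)) / η := by
    field_simp
    try ring
  rw [eA] at C1 C2
  have C2' := (aux_h_cont.tendsto _).comp C2.sqrt
  have eB : ((g * η * ω + γ * (g - 1) * (1 - η)) / η * ω - g * (ω ^ 2 - 1)) * ((g - 1) * ω) /
      ((g * η * ω + γ * (g - 1) * (1 - η)) / η * (g - 1)) =
      ω * (g * η + γ * ω * (g - 1) * (1 - η)) / (g * η * ω + γ * (g - 1) * (1 - η)) := by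
    field_simp
    ring
  rw [eB] at C2'
  generalize hKd : g * η * ω + γ * (g - 1) * (1 - η) = K at *
  have T1' : Tendsto (fun μ => (Delta g ω μ + √((Delta g ω μ) ^ 2 - 4 * Dprod g ω μ)) / 2 / μ ^ 2)
      atTop (nhds ((g - 1) ^ 2)) := by simpa using T1
  set L1 := fun μ => (Delta g ω μ + √((Delta g ω μ) ^ 2 - 4 * Dprod g ω μ)) / 2 with hL1
  set L2 := fun μ => (Δb μ + √((Δb μ) ^ 2 - 4 * Db μ)) / 2 with hL2
  have hT0 : 0 < (g - 1) ^ 2 := by positivity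
  have hC0 : 0 < K / η * (g - 1) := by positivity
  have A1 : Tendsto L1 atTop atTop := by
    refine (T1'.pos_mul_atTop hT0 (tendsto_pow_atTop (α := ℝ) two_ne_zero)).congr' ?_
    filter_upwards [eventually_gt_atTop 0] with μ hμ
    simp only [hL1]
    field_simp
  have A2 : Tendsto L2 atTop atTop := by
    refine (C1.pos_mul_atTop hC0 tendsto_id).congr' ?_
    filter_upwards [eventually_gt_atTop 0] with μ hμ
    simp only [id, hL2]
    field_simp
  obtain ⟨c, hc⟩ := aux_h_asymp
  have H1 := hc.comp (Real.tendsto_sqrt_atTop.comp A1)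
  have H2 := hc.comp (Real.tendsto_sqrt_atTop.comp A2)
  have R : Tendsto (fun μ => Real.logb 2 (L1 μ / μ ^ 2) / 2 - Real.logb 2 (L2 μ / μ) / 2) atTop
      (nhds (Real.logb 2 ((g - 1) ^ 2) / 2 - Real.logb 2 (K / η * (g - 1)) / 2)) := by
    simp only [Real.logb]
    exact (((T1'.log hT0.ne').div_const _).div_const _).sub
      (((C1.log hC0.ne').div_const _).div_const _)
  have F := ((((H1.sub H2).add R).add T2').sub C2').sub_const
    ((Real.logb 2 ((g - 1) ^ 2) / 2 - Real.logb 2 (K / η * (g - 1)) / 2) + h ω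
      - h √(ω * (g * η + γ * ω * (g - 1) * (1 - η)) / K))
  refine (F.congr' ?_).trans (le_of_eq (by congr 1; ring))
  filter_upwards [eventually_gt_atTop 0, A1.eventually_gt_atTop 0, A2.eventually_gt_atTop 0]
    with μ hμ p1 p2
  have s1 : Real.logb 2 √(L1 μ) = Real.logb 2 (L1 μ) / 2 := by
    simp only [Real.logb, Real.log_sqrt p1.le]; ring
  have s2 : Real.logb 2 √(L2 μ) = Real.logb 2 (L2 μ) / 2 := by
    simp only [Real.logb, Real.log_sqrt p2.le]; ring
  have hn : nu1 g ω μ = √(L1 μ) := rfl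
  have hm : √((Δb μ + √((Δb μ) ^ 2 - 4 * Db μ)) / 2) = √(L2 μ) := rfl
  rw [hn, hm]
  simp only [Function.comp_apply, s1, s2]
  rw [Real.logb_div p1.ne' (by positivity), Real.logb_div p2.ne' hμ.ne',
    Real.logb_div (by positivity) hK.ne', Real.logb_mul (by positivity) hg0.ne',
    Real.logb_div hK.ne' hη0.ne', Real.logb_mul (by positivity) hμ.ne',
    Real.logb_mul hg0.ne' hη0.ne', Real.logb_pow, Real.logb_pow]
  push_cast
  ring
end

section
/- Fix g > 1, ω > 1, γ ≥ 1, η ∈ (0,1). For μ > 1 let M(μ) := V_{E′e}(μ) − (1/V_B(μ))·w(μ)·w(μ)ᵀ, where V_{E′e}(μ) = [[((g−1)μ+gω)·I, √(g(ω²−1))·Z],[√(g(ω²−1))·Z, ω·I]], V_B(μ) = η(gμ+(g−1)ω)+(1−η)γ, and w(μ) is the column vector ( √(g(g−1)η)·(μ+ω), 0, √((g−1)η(ω²−1)), 0 )ᵀ (conditioning on Bob's q-homodyne). Let Δ̄(μ), D̄(μ) be defined by charpoly(Ω₂·M(μ)) = X⁴ + Δ̄(μ)·X² + D̄(μ), and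 set ν̄₁(μ) := √((Δ̄(μ)+√(Δ̄(μ)²−4D̄(μ)))/2), ν̄₂(μ) := √((Δ̄(μ)−√(Δ̄(μ)²−4D̄(μ)))/2). Then ν̄₁(μ)/√μ → √( (g−1)·[η·ω + γ·(g−1)·(1−η)]/(g·η) ) and ν̄₂(μ) → √( ω·[η + γ·ω·(g−1)·(1−η)] / (η·ω + γ·(g−1)·(1−η)) ) as μ → ∞. -/
open Real Filter Matrix Polynomial

/-- Bob's detected variance `V_B(μ) = η(gμ+(g−1)ω)+(1−η)γ`. -/
noncomputable def VB (g ω γ η μ : ℝ) : ℝ :=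
  η * (g * μ + (g - 1) * ω) + (1 - η) * γ

/-- The RR conditioning vector `w(μ) = (√(g(g−1)η)(μ+ω), 0, √((g−1)η(ω²−1)), 0)ᵀ`. -/
noncomputable def wRR (g ω η μ : ℝ) : Fin 4 → ℝ :=
  ![Real.sqrt (g * (g - 1) * η) * (μ + ω), 0, Real.sqrt ((g - 1) * η * (ω ^ 2 - 1)), 0]

/-- Eve's conditional covariance matrix after Bob's `q`-homodyne:
`M(μ) = V_{E′e}(μ) − (1/V_B(μ))·w(μ)w(μ)ᵀ`. -/
noncomputable def Mrr (g ω γ η μ : ℝ) : Matrix (Fin 4) (Fin 4) ℝ :=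
  VEe g ω μ - (VB g ω γ η μ)⁻¹ • Matrix.vecMulVec (wRR g ω η μ) (wRR g ω η μ)

theorem aux_char_s17 (a d b A c w Δ D : ℝ)
    (h : Matrix.charpoly (Omega2 * !![a, 0, d, 0; 0, A, 0, -c; d, 0, b, 0; 0, -c, 0, w]) =
      X ^ 4 + C Δ * X ^ 2 + C D) :
    Δ = a * A - 2 * c * d + b * w ∧ D = (a * b - d ^ 2) * (A * w - c ^ 2) := by
  have key : ∀ t : ℝ, t ^ 4 + Δ * t ^ 2 + D =
      t ^ 4 + (a * A - 2 * c * d + b * w) * t ^ 2 + (a * b - d ^ 2) * (A * w - c ^ 2) := by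
    intro t
    have h2 := congrArg (Polynomial.eval t) h
    rw [Matrix.eval_charpoly] at h2
    simp only [eval_add, eval_mul, eval_pow, eval_X, eval_C] at h2
    rw [← h2]
    have e : (Matrix.scalar (Fin 4) t -
        Omega2 * !![a, 0, d, 0; 0, A, 0, -c; d, 0, b, 0; 0, -c, 0, w]) =
        !![t, -A, 0, c; a, t, d, 0; 0, c, t, -w; d, 0, b, t] := by
      ext i j
      fin_cases i <;> fin_cases j <;>
        simp [Omega2, Matrix.mul_apply, Fin.sum_univ_succ]
    rw [e]
    simp [Matrix.det_succ_row_zero, Fin.sum_univ_succ, Fin.succAbove]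
    ring
  have h0 := key 0
  have h1 := key 1
  norm_num at h0 h1
  constructor
  · linarith
  · exact h0

theorem aux_M (g ω γ η μ : ℝ) (hg : 1 < g) (hω : 1 < ω) (hη : 0 < η) :
    Mrr g ω γ η μ =
      !![((g - 1) * μ + g * ω) - g * (g - 1) * η * (μ + ω) ^ 2 / VB g ω γ η μ, 0,
          √(g * (ω ^ 2 - 1)) * (1 - (g - 1) * η * (μ + ω) / VB g ω γ η μ), 0;
        0, (g - 1) * μ + g * ω, 0, -√(g * (ω ^ 2 - 1));
        √(g * (ω ^ 2 - 1)) * (1 - (g - 1) * η * (μ + ω) / VB g ω γ η μ), 0,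
          ω - (g - 1) * η * (ω ^ 2 - 1) / VB g ω γ η μ, 0;
        0, -√(g * (ω ^ 2 - 1)), 0, ω] := by
  have hg1 : 0 < g - 1 := by linarith
  have hw : 0 < ω ^ 2 - 1 := by nlinarith
  have hg0 : 0 < g := by linarith
  have s1 : √(g * (g - 1) * η) * √(g * (g - 1) * η) = g * (g - 1) * η :=
    Real.mul_self_sqrt (by positivity)
  have s3 : √((g - 1) * η * (ω ^ 2 - 1)) * √((g - 1) * η * (ω ^ 2 - 1))
      = (g - 1) * η * (ω ^ 2 - 1) := Real.mul_self_sqrt (by positivity)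
  have s2 : √(g * (g - 1) * η) * √((g - 1) * η * (ω ^ 2 - 1))
      = (g - 1) * η * √(g * (ω ^ 2 - 1)) := by
    rw [← Real.sqrt_mul (by positivity),
      show g * (g - 1) * η * ((g - 1) * η * (ω ^ 2 - 1))
        = ((g - 1) * η) ^ 2 * (g * (ω ^ 2 - 1)) by ring,
      Real.sqrt_mul (by positivity), Real.sqrt_sq (by positivity)]
  generalize hv : VB g ω γ η μ = v
  ext i j
  fin_cases i <;> fin_cases j <;>
    simp [Mrr, VEe, wRR, Matrix.vecMulVec_apply, hv]
  · linear_combination (v⁻¹ * (μ + ω) ^ 2) * s1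
  · linear_combination (-(v⁻¹ * (μ + ω))) * s2
  · linear_combination (-(v⁻¹ * (μ + ω))) * s2
  · linear_combination v⁻¹ * s3

theorem aux_rat (p2 p1 p0 a b : ℝ) (ha : 0 < a) :
    Tendsto (fun μ : ℝ => (p2 * μ ^ 2 + p1 * μ + p0) / (a * μ + b) / μ) atTop
      (nhds (p2 / a)) := by
  have hi : Tendsto (fun μ : ℝ => μ⁻¹) atTop (nhds 0) := tendsto_inv_atTop_zero
  have h : Tendsto (fun μ : ℝ => (p2 + p1 * μ⁻¹ + p0 * μ⁻¹ ^ 2) / (a + b * μ⁻¹)) atTop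
      (nhds ((p2 + p1 * 0 + p0 * 0 ^ 2) / (a + b * 0))) := by
    apply Tendsto.div
    · exact (tendsto_const_nhds.add (hi.const_mul _)).add ((hi.pow 2).const_mul _)
    · exact tendsto_const_nhds.add (hi.const_mul _)
    · simpa using ha.ne'
  simp only [mul_zero, add_zero, ne_eq, OfNat.ofNat_ne_zero, not_false_eq_true, zero_pow] at h
  refine h.congr' ?_
  filter_upwards [eventually_gt_atTop 0] with μ hμ
  rw [div_div, show (a * μ + b) * μ = μ ^ 2 * (a + b * μ⁻¹) by field_simp,
    show p2 * μ ^ 2 + p1 * μ + p0 = μ ^ 2 * (p2 + p1 * μ⁻¹ + p0 * μ⁻¹ ^ 2) by field_simp,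
    mul_div_mul_left _ _ (by positivity)]

theorem aux_lim (Δ D : ℝ → ℝ) (L1 L2 : ℝ) (hL : 0 < L1)
    (h1 : Tendsto (fun μ => Δ μ / μ) atTop (nhds L1))
    (h2 : Tendsto (fun μ => D μ / μ) atTop (nhds L2)) :
    Tendsto (fun μ : ℝ => √((Δ μ + √((Δ μ) ^ 2 - 4 * D μ)) / 2) / √μ) atTop (nhds √L1) ∧
    Tendsto (fun μ : ℝ => √((Δ μ - √((Δ μ) ^ 2 - 4 * D μ)) / 2)) atTop
      (nhds √(L2 / L1)) := by
  have hi : Tendsto (fun μ : ℝ => μ⁻¹) atTop (nhds 0) := tendsto_inv_atTop_zero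
  have hd : Tendsto (fun μ => (Δ μ / μ) ^ 2 - 4 * (D μ / μ * μ⁻¹)) atTop (nhds (L1 ^ 2)) := by
    simpa using (h1.pow 2).sub ((h2.mul hi).const_mul 4)
  have hs : Tendsto (fun μ => (Δ μ / μ + √((Δ μ / μ) ^ 2 - 4 * (D μ / μ * μ⁻¹))) / 2) atTop
      (nhds L1) := by
    have := (h1.add hd.sqrt).div_const 2
    rw [Real.sqrt_sq hL.le] at this
    simpa using this
  have hsq : ∀ μ : ℝ, 0 < μ → √((Δ μ) ^ 2 - 4 * D μ)
      = μ * √((Δ μ / μ) ^ 2 - 4 * (D μ / μ * μ⁻¹)) := by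
    intro μ hμ
    rw [show (Δ μ) ^ 2 - 4 * D μ = μ ^ 2 * ((Δ μ / μ) ^ 2 - 4 * (D μ / μ * μ⁻¹)) by
      field_simp, Real.sqrt_mul (by positivity), Real.sqrt_sq hμ.le]
  constructor
  · refine hs.sqrt.congr' ?_
    filter_upwards [eventually_gt_atTop 0] with μ hμ
    rw [← Real.sqrt_div' _ hμ.le, hsq μ hμ]
    congr 1
    field_simp
  · refine ((h2.div hs hL.ne').sqrt).congr' ?_
    filter_upwards [eventually_gt_atTop 0, hd.eventually_const_lt (by positivity : 0 < L1 ^ 2),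
      hs.eventually_const_lt hL] with μ hμ hd0 hs0
    rw [hsq μ hμ]
    congr 1
    have e := Real.mul_self_sqrt hd0.le
    simp only [Pi.div_apply]
    rw [div_eq_iff hs0.ne']
    generalize √((Δ μ / μ) ^ 2 - 4 * (D μ / μ * μ⁻¹)) = r at *
    have e3 : Δ μ = Δ μ / μ * μ := by field_simp
    have e2 : D μ / μ * μ⁻¹ * μ = D μ / μ := by field_simp
    generalize Δ μ / μ = x at *
    rw [e3]
    linear_combination (-e2) + (μ / 4) * e

/-- Asymptotics of the conditional symplectic eigenvalues in RR:
`ν̄₁(μ)/√μ → √((g−1)[ηω+γ(g−1)(1−η)]/(gη))` and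
`ν̄₂(μ) → √(ω[η+γω(g−1)(1−η)]/(ηω+γ(g−1)(1−η)))`, where `ν̄₁, ν̄₂` are defined through
`charpoly(Ω₂M(μ)) = X⁴ + Δ̄(μ)X² + D̄(μ)`. -/
theorem conditional_spectrum_asymptotics_RR (g ω γ η : ℝ)
    (hg : 1 < g) (hω : 1 < ω) (hγ : 1 ≤ γ) (hη : η ∈ Set.Ioo (0 : ℝ) 1)
    (Δb Db : ℝ → ℝ)
    (hchar : ∀ μ : ℝ, 1 < μ →
      Matrix.charpoly (Omega2 * Mrr g ω γ η μ) =
        X ^ 4 + C (Δb μ) * X ^ 2 + C (Db μ)) :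
    Filter.Tendsto
      (fun μ : ℝ =>
        Real.sqrt ((Δb μ + Real.sqrt ((Δb μ) ^ 2 - 4 * Db μ)) / 2) / Real.sqrt μ)
      Filter.atTop
      (nhds (Real.sqrt ((g - 1) * (η * ω + γ * (g - 1) * (1 - η)) / (g * η)))) ∧
    Filter.Tendsto
      (fun μ : ℝ =>
        Real.sqrt ((Δb μ - Real.sqrt ((Δb μ) ^ 2 - 4 * Db μ)) / 2))
      Filter.atTop
      (nhds (Real.sqrt (ω * (η + γ * ω * (g - 1) * (1 - η)) /
        (η * ω + γ * (g - 1) * (1 - η))))) := by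
  obtain ⟨hη0, hη1⟩ := hη
  have hg1 : 0 < g - 1 := by linarith
  have hg0 : 0 < g := by linarith
  have hw0 : 0 < ω := by linarith
  have hw : 0 < ω ^ 2 - 1 := by nlinarith
  have hη' : 0 < 1 - η := by linarith
  have hγ0 : 0 < γ := by linarith
  have hcc : √(g * (ω ^ 2 - 1)) ^ 2 = g * (ω ^ 2 - 1) := Real.sq_sqrt (by positivity)
  set k : ℝ := η * (g - 1) * ω + (1 - η) * γ with hk
  have hV : ∀ μ, VB g ω γ η μ = g * η * μ + k := by
    intro μ; simp only [VB, hk]; ring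
  have hk0 : 0 < k := by positivity
  set a1 : ℝ := η * ω + γ * (g - 1) * (1 - η) with ha1
  set a0 : ℝ := g * ω * k - g * (g - 1) * η * ω ^ 2 with ha0
  set b1 : ℝ := η + γ * ω * (g - 1) * (1 - η) with hb1
  set b0 : ℝ := (g * k - ω * (g * (g - 1) * η * ω ^ 2) + 2 * (g * (ω ^ 2 - 1)) * (g - 1) * η * ω
    - g * ω * ((g - 1) * η * (ω ^ 2 - 1))) with hb0
  have hΔD : ∀ μ, 1 < μ →
      Δb μ = ((g - 1) * a1 * μ ^ 2
        + (a1 * (g * ω) + a0 * (g - 1) - 2 * (g * (ω ^ 2 - 1)) * (g * η - (g - 1) * η)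
          + g * η * ω * ω) * μ
        + (a0 * g * ω - 2 * (g * (ω ^ 2 - 1)) * (k - (g - 1) * η * ω)
          + ω * (ω * k - (g - 1) * η * (ω ^ 2 - 1)))) / (g * η * μ + k) ∧
      Db μ = (b1 * ((g - 1) * ω) * μ ^ 2 + (b1 * g + b0 * ((g - 1) * ω)) * μ + b0 * g)
        / (g * η * μ + k) := by
    intro μ hμ
    have h := hchar μ hμ
    rw [aux_M g ω γ η μ hg hω hη0] at h
    obtain ⟨e1, e2⟩ := aux_char_s17 _ _ _ _ _ _ _ _ h
    rw [hV] at e1 e2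
    have hv : g * η * μ + k ≠ 0 := by positivity
    generalize √(g * (ω ^ 2 - 1)) = c at *
    constructor
    · rw [e1, eq_div_iff hv]
      rw [show 2 * c * (c * (1 - (g - 1) * η * (μ + ω) / (g * η * μ + k))) =
        2 * c ^ 2 * (1 - (g - 1) * η * (μ + ω) / (g * η * μ + k)) by ring, hcc]
      field_simp
      simp only [ha1, ha0, hk]
      ring
    · rw [e2, eq_div_iff hv, mul_pow, hcc]
      field_simp
      simp only [hb1, hb0, hk]
      ring
  obtain ⟨p1, p0, q1, q0, hpq⟩ : ∃ p1 p0 q1 q0 : ℝ, ∀ μ, 1 < μ →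
      Δb μ = ((g - 1) * a1 * μ ^ 2 + p1 * μ + p0) / (g * η * μ + k) ∧
      Db μ = (b1 * ((g - 1) * ω) * μ ^ 2 + q1 * μ + q0) / (g * η * μ + k) :=
    ⟨_, _, _, _, hΔD⟩
  have ha1p : 0 < a1 := by positivity
  have t1 : Tendsto (fun μ => Δb μ / μ) atTop (nhds ((g - 1) * a1 / (g * η))) := by
    refine (aux_rat _ p1 p0 (g * η) k (by positivity)).congr' ?_
    filter_upwards [eventually_gt_atTop 1] with μ hμ
    rw [(hpq μ hμ).1]
  have t2 : Tendsto (fun μ => Db μ / μ) atTop (nhds (b1 * ((g - 1) * ω) / (g * η))) := by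
    refine (aux_rat _ q1 q0 (g * η) k (by positivity)).congr' ?_
    filter_upwards [eventually_gt_atTop 1] with μ hμ
    rw [(hpq μ hμ).2]
  have := aux_lim Δb Db _ _ (by positivity) t1 t2
  rwa [show b1 * ((g - 1) * ω) / (g * η) / ((g - 1) * a1 / (g * η)) = ω * b1 / a1 by
    field_simp] at this
end
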